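/- Let T be a woven based matrix over ℤ. For g ∈ G∪I and 1 ≤ j ≤ n set n_j(g) = b(g,s_j), and for each i define u_i(T) = Σ_{g∈G_i\{s_i}} sign(n_i(g))·t^{|n_i(g)|}·∏_{j≠i}(x^{n_j(g)} + x^{n_j(s_i)-n_j(g)}), an element of the ring ℤ[t][x,x^{-1}] of Laurent polynomials in x over ℤ[t]. If T' is obtained from T by an elementary extension applied to some G_{i'} or to I, by the inverse of such an extension, or by an intersection move, then u_i(T') = u_i(T) for every i = 1,…,n. -/

import Mathlib

universe u v

/-- A woven based matrix over an abelian group `H`: parts `G 1, …, G n` with base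
elements `s i ∈ G i`, a weaving set `I`, and a skew-symmetric pairing `b` which is a
weaving map on `(G ∪ I) × I`. -/
structure WovenBasedMatrix (α : Type u) (H : Type v) [DecidableEq α] [AddCommGroup H]
    (n : ℕ) where
  G : Fin n → Finset α
  I : Finset α
  s : Fin n → α
  b : α → α → H
  s_mem : ∀ i, s i ∈ G i
  disjointG : ∀ i j, i ≠ j → Disjoint (G i) (G j)
  disjointI : ∀ i, Disjoint (G i) I
  skew : ∀ a ∈ Finset.univ.biUnion G ∪ I, ∀ a' ∈ Finset.univ.biUnion G ∪ I,
    b a a' = - b a' a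
  diag : ∀ a ∈ Finset.univ.biUnion G ∪ I, b a a = 0
  inter_zero : ∀ x ∈ I, ∀ y ∈ I, b x y = 0
  weave_two : ∀ x ∈ I, ∃ i j : Fin n, i ≠ j ∧ b (s i) x ≠ 0 ∧ b (s j) x ≠ 0 ∧
    b (s i) x = - b (s j) x ∧ ∀ k : Fin n, b (s k) x ≠ 0 → k = i ∨ k = j
  weave_val : ∀ i : Fin n, ∀ g ∈ G i, ∀ x ∈ I, b g x = 0 ∨ b g x = b (s i) x

variable {α : Type u} {H : Type v} [DecidableEq α] [AddCommGroup H] {n : ℕ}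

/-- The underlying set `G ∪ I` of a woven based matrix. -/
def WovenBasedMatrix.carrier (T : WovenBasedMatrix α H n) : Finset α :=
  Finset.univ.biUnion T.G ∪ T.I

/-- The effect of the intersection move `I_□(g; x₁, x₂)` on the skew-symmetric map `b`,
where `sj` is the base element of the part containing `g`:
`b' g xₖ = b sj xₖ - b g xₖ` for `k = 1,2` (and symmetrically), `b' = b` elsewhere. -/
def IMap (b : α → α → H) (sj g x1 x2 : α) : α → α → H := fun a a' =>
  if a = g ∧ (a' = x1 ∨ a' = x2) then b sj a' - b a a'
  else if a' = g ∧ (a = x1 ∨ a = x2) then b a sj - b a a'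
  else b a a'

/-- `x₁, x₂` are a `g`-annihilating pair (with `sj` the base element of `g`'s part). -/
def IsGAnn (b : α → α → H) (sj g x1 x2 : α) : Prop :=
  b g x1 + b g x2 = 0 ∧ b sj x1 + b sj x2 = 0

/-- `x₁, x₂` are a `g`-unequal pair (with `sj` the base element of `g`'s part). -/
def IsGUnequal (b : α → α → H) (sj g x1 x2 : α) : Prop :=
  b g x1 ≠ b g x2 ∧ b sj x1 = b sj x2

/-- `MoveApplicable k b sj g x1 x2`: the intersection move `I_{k+1}(g;x₁,x₂)` is applicable to
the matrix `b`.  Here `k = 0` encodes the move `I₁` (needing a `g`-annihilating pair) and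
`k = 1` encodes the move `I₂` (needing a `g`-unequal pair). -/
def MoveApplicable (k : Fin 2) (b : α → α → H) (sj g x1 x2 : α) : Prop :=
  if k = 0 then IsGAnn b sj g x1 x2 else IsGUnequal b sj g x1 x2

/-- The data of an intersection move `I_{sq+1}(g; x₁, x₂)` with `g` in the part `G j`. -/
structure MoveDatum (α : Type u) (n : ℕ) where
  j : Fin n
  sq : Fin 2
  g : α
  x1 : α
  x2 : α

/-- The move datum refers to an element `g ∈ G j \ {s j}` and a pair of distinct
elements of the weaving set `I`. -/
def MoveDatum.valid (m : MoveDatum α n) (T : WovenBasedMatrix α H n) : Prop :=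
  m.g ∈ T.G m.j ∧ m.g ≠ T.s m.j ∧ m.x1 ∈ T.I ∧ m.x2 ∈ T.I ∧ m.x1 ≠ m.x2

/-- Apply a finite sequence of intersection moves (listed in order of application)
to the skew-symmetric map `b`. -/
def applyMoves (s : Fin n → α) : List (MoveDatum α n) → (α → α → H) → (α → α → H)
  | [], b => b
  | m :: ms, b => applyMoves s ms (IMap b (s m.j) m.g m.x1 m.x2)

/-- A finite sequence of intersection moves is applicable to `b`: each move in turn is
applicable to the result of the previous ones. -/
def movesApplicable (s : Fin n → α) : List (MoveDatum α n) → (α → α → H) → Prop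
  | [], _ => True
  | m :: ms, b => MoveApplicable m.sq b (s m.j) m.g m.x1 m.x2 ∧
      movesApplicable s ms (IMap b (s m.j) m.g m.x1 m.x2)

/-- A sequence of intersection moves is reduced if it splits into consecutive blocks,
each block acting on a single element `g` of `G`, with pairwise distinct elements `g`
across blocks, and within each block every element of the weaving set appears in at
most one move. -/
def ReducedMoves (L : List (MoveDatum α n)) : Prop :=
  ∃ Bs : List (List (MoveDatum α n)),
    L = Bs.flatten ∧
    (∀ B ∈ Bs, ∀ m ∈ B, ∀ m' ∈ B, m.g = m'.g) ∧
    Bs.Pairwise (fun B B' => ∀ m ∈ B, ∀ m' ∈ B', m.g ≠ m'.g) ∧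
    (∀ B ∈ Bs, ∀ x : α, (B.countP fun m => decide (m.x1 = x ∨ m.x2 = x)) ≤ 1)

/-- `M_{1,j}`: elementary extension adding a `G j`-annihilating element `g`. -/
def ExtRel1 (T T' : WovenBasedMatrix α H n) : Prop :=
  ∃ (j : Fin n) (g : α), g ∉ T.carrier ∧
    T'.s = T.s ∧ T'.I = T.I ∧ T'.G j = insert g (T.G j) ∧
    (∀ i : Fin n, i ≠ j → T'.G i = T.G i) ∧
    (∀ a ∈ T.carrier, ∀ a' ∈ T.carrier, T'.b a a' = T.b a a') ∧
    (∀ a ∈ T'.carrier, T'.b g a = 0)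

/-- `M_{2,j}`: elementary extension adding a `G j`-core element `g`. -/
def ExtRel2 (T T' : WovenBasedMatrix α H n) : Prop :=
  ∃ (j : Fin n) (g : α), g ∉ T.carrier ∧
    T'.s = T.s ∧ T'.I = T.I ∧ T'.G j = insert g (T.G j) ∧
    (∀ i : Fin n, i ≠ j → T'.G i = T.G i) ∧
    (∀ a ∈ T.carrier, ∀ a' ∈ T.carrier, T'.b a a' = T.b a a') ∧
    (∀ a ∈ T'.carrier, T'.b g a = T'.b (T'.s j) a)

/-- `M_{3,j}`: elementary extension adding a `G j`-complementary pair `g₁, g₂`. -/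
def ExtRel3 (T T' : WovenBasedMatrix α H n) : Prop :=
  ∃ (j : Fin n) (g1 g2 : α), g1 ≠ g2 ∧ g1 ∉ T.carrier ∧ g2 ∉ T.carrier ∧
    T'.s = T.s ∧ T'.I = T.I ∧ T'.G j = insert g1 (insert g2 (T.G j)) ∧
    (∀ i : Fin n, i ≠ j → T'.G i = T.G i) ∧
    (∀ a ∈ T.carrier, ∀ a' ∈ T.carrier, T'.b a a' = T.b a a') ∧
    (∀ a ∈ T'.carrier, T'.b g1 a + T'.b g2 a = T'.b (T'.s j) a)

/-- `M₄`: elementary extension adding a sum-annihilating pair `x₁, x₂` to the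
weaving set. -/
def ExtRel4 (T T' : WovenBasedMatrix α H n) : Prop :=
  ∃ (x1 x2 : α), x1 ≠ x2 ∧ x1 ∉ T.carrier ∧ x2 ∉ T.carrier ∧
    T'.s = T.s ∧ T'.G = T.G ∧ T'.I = insert x1 (insert x2 T.I) ∧
    (∀ a ∈ T.carrier, ∀ a' ∈ T.carrier, T'.b a a' = T.b a a') ∧
    (∀ a ∈ T'.carrier, T'.b x1 a + T'.b x2 a = 0)

/-- `T'` is obtained from `T` by a single elementary extension; the inverse elementary
extensions are given by the reversed relation. -/
def ExtRel (T T' : WovenBasedMatrix α H n) : Prop :=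
  ExtRel1 T T' ∨ ExtRel2 T T' ∨ ExtRel3 T T' ∨ ExtRel4 T T'

/-- `T'` is obtained from `T` by the elementary extension `M_k` (`k ∈ {1,2,3,4}`). -/
def ExtRelAt (k : ℕ) (T T' : WovenBasedMatrix α H n) : Prop :=
  match k with
  | 1 => ExtRel1 T T'
  | 2 => ExtRel2 T T'
  | 3 => ExtRel3 T T'
  | 4 => ExtRel4 T T'
  | _ => False

/-- Isomorphism of woven based matrices: a bijection of the underlying sets together with
a permutation of the indices, matching base elements, parts, weaving sets and pairings. -/
def IsoRel (T T' : WovenBasedMatrix α H n) : Prop :=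
  ∃ (Φ : α → α) (σ : Equiv.Perm (Fin n)),
    Set.BijOn Φ ↑T.carrier ↑T'.carrier ∧
    (∀ i, Φ (T.s i) = T'.s (σ i)) ∧
    (∀ i, (T.G i).image Φ = T'.G (σ i)) ∧
    T.I.image Φ = T'.I ∧
    (∀ a ∈ T.carrier, ∀ a' ∈ T.carrier, T'.b (Φ a) (Φ a') = T.b a a')

/-- `T'` is obtained from `T` by a single intersection move. -/
def IMoveRel (T T' : WovenBasedMatrix α H n) : Prop :=
  ∃ m : MoveDatum α n, m.valid T ∧
    MoveApplicable m.sq T.b (T.s m.j) m.g m.x1 m.x2 ∧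
    T'.G = T.G ∧ T'.I = T.I ∧ T'.s = T.s ∧
    (∀ a ∈ T.carrier, ∀ a' ∈ T.carrier,
      T'.b a a' = IMap T.b (T.s m.j) m.g m.x1 m.x2 a a')

/-- `T` and `T'` are equal woven based matrices (same parts, base elements, weaving set
and the same pairing on the underlying set). -/
def WBMEq (T T' : WovenBasedMatrix α H n) : Prop :=
  T'.G = T.G ∧ T'.I = T.I ∧ T'.s = T.s ∧
  ∀ a ∈ T.carrier, ∀ a' ∈ T.carrier, T'.b a a' = T.b a a'

/-- One step of the homology relation: an elementary extension, an inverse elementary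
extension, an intersection move, or an isomorphism. -/
def HomStep (T T' : WovenBasedMatrix α H n) : Prop :=
  ExtRel T T' ∨ ExtRel T' T ∨ IMoveRel T T' ∨ IsoRel T T'

/-- Two woven based matrices are homologous if they are related by a finite sequence of
elementary extensions and their inverses, intersection moves, and isomorphisms. -/
def Homologous : WovenBasedMatrix α H n → WovenBasedMatrix α H n → Prop :=
  Relation.ReflTransGen HomStep

/-- No inverse elementary extension applies to `T`: there is no `G i`-annihilating
element, no `G i`-core element, no `G i`-complementary pair, and no sum-annihilating
pair in the weaving set. -/
def NoInverseExtension (T : WovenBasedMatrix α H n) : Prop :=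
  (∀ i : Fin n, ∀ g ∈ T.G i, g ≠ T.s i → ¬ (∀ a ∈ T.carrier, T.b g a = 0)) ∧
  (∀ i : Fin n, ∀ g ∈ T.G i, g ≠ T.s i →
    ¬ (∀ a ∈ T.carrier, T.b g a = T.b (T.s i) a)) ∧
  (∀ i : Fin n, ∀ g1 ∈ T.G i, ∀ g2 ∈ T.G i, g1 ≠ T.s i → g2 ≠ T.s i → g1 ≠ g2 →
    ¬ (∀ a ∈ T.carrier, T.b g1 a + T.b g2 a = T.b (T.s i) a)) ∧
  (∀ x1 ∈ T.I, ∀ x2 ∈ T.I, x1 ≠ x2 → ¬ (∀ a ∈ T.carrier, T.b x1 a + T.b x2 a = 0))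

/-- A woven based matrix is primitive if after every finite sequence of intersection
moves, no inverse elementary extension can be applied. -/
def Primitive (T : WovenBasedMatrix α H n) : Prop :=
  ∀ T' : WovenBasedMatrix α H n, Relation.ReflTransGen IMoveRel T T' →
    NoInverseExtension T'

/-- The `u`-polynomial `u_i(T)` of a woven based matrix over `ℤ`, an element of the ring
`ℤ[t][x,x⁻¹]`:  `u_i(T) = Σ_{g ∈ G_i \ {s_i}} sign(n_i(g)) t^{|n_i(g)|}
∏_{j ≠ i} (x^{n_j(g)} + x^{n_j(s_i) - n_j(g)})` where `n_j(g) = b g (s j)`. -/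
noncomputable def uPoly {α : Type u} [DecidableEq α] {n : ℕ}
    (T : WovenBasedMatrix α ℤ n) (i : Fin n) : LaurentPolynomial (Polynomial ℤ) :=
  ∑ g ∈ (T.G i).erase (T.s i),
    LaurentPolynomial.C
        (Polynomial.C ((T.b g (T.s i)).sign) * Polynomial.X ^ (T.b g (T.s i)).natAbs) *
      ∏ j ∈ Finset.univ.erase i,
        (LaurentPolynomial.T (T.b g (T.s j)) +
          LaurentPolynomial.T (T.b (T.s i) (T.s j) - T.b g (T.s j)))

namespace WovenBasedMatrix

/-- The contribution of an element `g` of the part `G i` to `uPoly T i`. -/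
noncomputable def uTerm (T : WovenBasedMatrix α ℤ n) (i : Fin n) (g : α) :
    LaurentPolynomial (Polynomial ℤ) :=
  LaurentPolynomial.C
      (Polynomial.C ((T.b g (T.s i)).sign) * Polynomial.X ^ (T.b g (T.s i)).natAbs) *
    ∏ j ∈ Finset.univ.erase i,
      (LaurentPolynomial.T (T.b g (T.s j)) +
        LaurentPolynomial.T (T.b (T.s i) (T.s j) - T.b g (T.s j)))

theorem uPoly_eq_sum_uTerm (T : WovenBasedMatrix α ℤ n) (i : Fin n) :
    uPoly T i = ∑ g ∈ (T.G i).erase (T.s i), T.uTerm i g := rfl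

theorem mem_carrier_of_mem_G (T : WovenBasedMatrix α H n) {i : Fin n} {g : α}
    (hg : g ∈ T.G i) : g ∈ T.carrier :=
  Finset.mem_union_left _ (Finset.mem_biUnion.2 ⟨i, Finset.mem_univ i, hg⟩)

theorem s_mem_carrier (T : WovenBasedMatrix α H n) (i : Fin n) : T.s i ∈ T.carrier :=
  T.mem_carrier_of_mem_G (T.s_mem i)

theorem uTerm_eq_zero (T : WovenBasedMatrix α ℤ n) {i : Fin n} {g : α}
    (h : T.b g (T.s i) = 0) : T.uTerm i g = 0 := by
  simp [uTerm, h]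

/-- Elements whose pairings with the base elements add up to those of `s i` have
opposite contributions. -/
theorem uTerm_add_uTerm_eq_zero (T : WovenBasedMatrix α ℤ n) {i : Fin n} {g₁ g₂ : α}
    (h : ∀ j, T.b g₁ (T.s j) + T.b g₂ (T.s j) = T.b (T.s i) (T.s j)) :
    T.uTerm i g₁ + T.uTerm i g₂ = 0 := by
  have hi : T.b g₂ (T.s i) = -T.b g₁ (T.s i) := by
    have := h i
    rw [T.diag _ (T.s_mem_carrier i)] at this
    lia
  have hj : ∀ j, T.b (T.s i) (T.s j) - T.b g₁ (T.s j) = T.b g₂ (T.s j) := fun j => by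
    rw [← h j]; ring
  have hj' : ∀ j, T.b (T.s i) (T.s j) - T.b g₂ (T.s j) = T.b g₁ (T.s j) := fun j => by
    rw [← h j]; ring
  simp only [uTerm, hj, hj', hi, Int.sign_neg, Int.natAbs_neg]
  rw [Finset.prod_congr rfl fun j _ =>
    add_comm (LaurentPolynomial.T (T.b g₂ (T.s j))) (LaurentPolynomial.T (T.b g₁ (T.s j))),
    ← add_mul, ← map_add, ← add_mul, ← map_add, add_neg_cancel, map_zero, zero_mul, map_zero,
    zero_mul]

theorem sum_uTerm_congr {T T' : WovenBasedMatrix α ℤ n} (i : Fin n) (hs : T'.s = T.s)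
    (hb : ∀ k, ∀ a ∈ T.G k, ∀ j, T'.b a (T.s j) = T.b a (T.s j)) :
    ∑ g ∈ (T.G i).erase (T.s i), T'.uTerm i g = uPoly T i := by
  rw [uPoly_eq_sum_uTerm]
  refine Finset.sum_congr rfl fun g hg => ?_
  simp only [uTerm, hs, hb i g (Finset.mem_of_mem_erase hg), hb i _ (T.s_mem i)]

theorem uPoly_eq_of_G_eq {T T' : WovenBasedMatrix α ℤ n} (i : Fin n) (hs : T'.s = T.s)
    (hG : T'.G i = T.G i)
    (hb : ∀ k, ∀ a ∈ T.G k, ∀ j, T'.b a (T.s j) = T.b a (T.s j)) :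
    uPoly T' i = uPoly T i := by
  rw [uPoly_eq_sum_uTerm, hG, hs, sum_uTerm_congr i hs hb]

theorem uPoly_eq_of_insert {T T' : WovenBasedMatrix α ℤ n} {j : Fin n} {g : α}
    (hg : g ∉ T.carrier) (hs : T'.s = T.s) (hGj : T'.G j = insert g (T.G j))
    (hG : ∀ i, i ≠ j → T'.G i = T.G i)
    (hb : ∀ a ∈ T.carrier, ∀ a' ∈ T.carrier, T'.b a a' = T.b a a')
    (h : T'.b g (T'.s j) = 0) (i : Fin n) : uPoly T' i = uPoly T i := by
  have hb' : ∀ k, ∀ a ∈ T.G k, ∀ j, T'.b a (T.s j) = T.b a (T.s j) := fun k a ha j =>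
    hb a (T.mem_carrier_of_mem_G ha) _ (T.s_mem_carrier j)
  obtain rfl | hij := eq_or_ne i j
  · have hgs : g ≠ T.s i := fun e => hg (e ▸ T.s_mem_carrier i)
    have hgG : g ∉ (T.G i).erase (T.s i) := fun e =>
      hg (T.mem_carrier_of_mem_G (Finset.mem_of_mem_erase e))
    rw [uPoly_eq_sum_uTerm, hGj, hs, Finset.erase_insert_of_ne hgs, Finset.sum_insert hgG,
      uTerm_eq_zero T' h, zero_add, sum_uTerm_congr i hs hb']
  · exact uPoly_eq_of_G_eq i hs (hG i hij) hb'

theorem uPoly_eq_of_extRel1 {T T' : WovenBasedMatrix α ℤ n} (h : ExtRel1 T T') (i : Fin n) :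
    uPoly T' i = uPoly T i := by
  obtain ⟨j, g, hg, hs, -, hGj, hG, hb, h0⟩ := h
  exact uPoly_eq_of_insert hg hs hGj hG hb (h0 _ (T'.s_mem_carrier j)) i

theorem uPoly_eq_of_extRel2 {T T' : WovenBasedMatrix α ℤ n} (h : ExtRel2 T T') (i : Fin n) :
    uPoly T' i = uPoly T i := by
  obtain ⟨j, g, hg, hs, -, hGj, hG, hb, hc⟩ := h
  exact uPoly_eq_of_insert hg hs hGj hG hb
    ((hc _ (T'.s_mem_carrier j)).trans (T'.diag _ (T'.s_mem_carrier j))) i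

theorem uPoly_eq_of_extRel3 {T T' : WovenBasedMatrix α ℤ n} (h : ExtRel3 T T') (i : Fin n) :
    uPoly T' i = uPoly T i := by
  obtain ⟨j, g₁, g₂, hne, hg₁, hg₂, hs, -, hGj, hG, hb, hc⟩ := h
  have hb' : ∀ k, ∀ a ∈ T.G k, ∀ j, T'.b a (T.s j) = T.b a (T.s j) := fun k a ha j =>
    hb a (T.mem_carrier_of_mem_G ha) _ (T.s_mem_carrier j)
  obtain rfl | hij := eq_or_ne i j
  · have hgs : ∀ g, g ∉ T.carrier → g ≠ T.s i := fun g hg e => hg (e ▸ T.s_mem_carrier i)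
    have hgG : ∀ g, g ∉ T.carrier → g ∉ (T.G i).erase (T.s i) := fun g hg e =>
      hg (T.mem_carrier_of_mem_G (Finset.mem_of_mem_erase e))
    have hg₁G : g₁ ∉ insert g₂ ((T.G i).erase (T.s i)) := by
      simp only [Finset.mem_insert, not_or]
      exact ⟨hne, hgG _ hg₁⟩
    rw [uPoly_eq_sum_uTerm, hGj, hs, Finset.erase_insert_of_ne (hgs _ hg₁),
      Finset.erase_insert_of_ne (hgs _ hg₂), Finset.sum_insert hg₁G,
      Finset.sum_insert (hgG _ hg₂), ← add_assoc,
      uTerm_add_uTerm_eq_zero T' fun k => hc _ (T'.s_mem_carrier k), zero_add,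
      sum_uTerm_congr i hs hb']
  · exact uPoly_eq_of_G_eq i hs (hG i hij) hb'

theorem uPoly_eq_of_extRel4 {T T' : WovenBasedMatrix α ℤ n} (h : ExtRel4 T T') (i : Fin n) :
    uPoly T' i = uPoly T i := by
  obtain ⟨x₁, x₂, -, -, -, hs, hG, -, hb, -⟩ := h
  exact uPoly_eq_of_G_eq i hs (congrFun hG i) fun k a ha j =>
    hb a (T.mem_carrier_of_mem_G ha) _ (T.s_mem_carrier j)

theorem uPoly_eq_of_extRel {T T' : WovenBasedMatrix α ℤ n} (h : ExtRel T T') (i : Fin n) :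
    uPoly T' i = uPoly T i := by
  rcases h with h | h | h | h
  · exact uPoly_eq_of_extRel1 h i
  · exact uPoly_eq_of_extRel2 h i
  · exact uPoly_eq_of_extRel3 h i
  · exact uPoly_eq_of_extRel4 h i

theorem uPoly_eq_of_iMoveRel {T T' : WovenBasedMatrix α ℤ n} (h : IMoveRel T T')
    (i : Fin n) : uPoly T' i = uPoly T i := by
  obtain ⟨m, ⟨-, -, hx₁, hx₂, -⟩, -, hG, -, hs, hb⟩ := h
  have hx : ∀ k, ∀ a ∈ T.G k, ¬(a = m.x1 ∨ a = m.x2) := by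
    rintro k a ha (rfl | rfl)
    · exact Finset.disjoint_left.1 (T.disjointI k) ha hx₁
    · exact Finset.disjoint_left.1 (T.disjointI k) ha hx₂
  refine uPoly_eq_of_G_eq i hs (congrFun hG i) fun k a ha j => ?_
  rw [hb a (T.mem_carrier_of_mem_G ha) _ (T.s_mem_carrier j), IMap,
    if_neg fun e => hx j _ (T.s_mem j) e.2, if_neg fun e => hx k a ha e.2]

end WovenBasedMatrix

/-- the polynomials `u_i` are invariant under elementary extensions,
inverse elementary extensions, and intersection moves. -/
theorem uPoly_invariant
    {α : Type u} [DecidableEq α] {n : ℕ}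
    (T T' : WovenBasedMatrix α ℤ n)
    (h : ExtRel T T' ∨ ExtRel T' T ∨ IMoveRel T T') :
    ∀ i : Fin n, uPoly T' i = uPoly T i := by
  intro i
  rcases h with h | h | h
  · exact WovenBasedMatrix.uPoly_eq_of_extRel h i
  · exact (WovenBasedMatrix.uPoly_eq_of_extRel h i).symm
  · exact WovenBasedMatrix.uPoly_eq_of_iMoveRel h i
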